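/- For all integers m, n ≥ 3, there exists a tight Heffter array H(m,n): an m × n matrix with nonzero entries from Z_{2mn+1} such that every row and column sums to 0 in Z_{2mn+1} and for every x in {1,...,mn} exactly one of x, -x appears, exactly once. -/

import Mathlib

/-- Some entry of the row is `±v`. -/
def RowCov {n : ℕ} (r : Fin n → ℤ) (v : ℤ) : Prop := ∃ j, r j = v ∨ r j = -v

/-- Some entry of the array is `±v`. -/
def MatCov {m n : ℕ} (A : Fin m → Fin n → ℤ) (v : ℤ) : Prop := ∃ i, RowCov (A i) v

theorem rowCov_cons {n : ℕ} (x : ℤ) (r : Fin n → ℤ) (v : ℤ) :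
    RowCov (Matrix.vecCons x r) v ↔ (x = v ∨ x = -v) ∨ RowCov r v := by
  unfold RowCov
  rw [Fin.exists_fin_succ]
  rfl

theorem rowCov_nil (r : Fin 0 → ℤ) (v : ℤ) : RowCov r v ↔ False := by
  simp [RowCov]

theorem matCov_cons {m n : ℕ} (r : Fin n → ℤ) (A : Fin m → Fin n → ℤ) (v : ℤ) :
    MatCov (Matrix.vecCons r A) v ↔ RowCov r v ∨ MatCov A v := by
  unfold MatCov
  rw [Fin.exists_fin_succ]
  rfl

theorem matCov_nil {n : ℕ} (A : Fin 0 → Fin n → ℤ) (v : ℤ) : MatCov A v ↔ False := by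
  simp [MatCov]

/-- `Good M m n S`: there is an `m × n` integer array all of whose row and column sums are divisible
by `M`, and whose entries cover, up to sign, every positive integer satisfying `S`. -/
def Good (M : ℤ) (m n : ℕ) (S : ℤ → Prop) : Prop :=
  ∃ A : Fin m → Fin n → ℤ, (∀ i, M ∣ ∑ j, A i j) ∧ (∀ j, M ∣ ∑ i, A i j) ∧
    ∀ v, 0 < v → S v → ∃ i j, A i j = v ∨ A i j = -v

theorem Good.mono {M : ℤ} {m n : ℕ} {S S' : ℤ → Prop} (h : Good M m n S)
    (hS : ∀ v, 0 < v → S' v → S v) : Good M m n S' := by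
  obtain ⟨A, h1, h2, h3⟩ := h
  exact ⟨A, h1, h2, fun v hv hs => h3 v hv (hS v hv hs)⟩

theorem Good.trans {M : ℤ} {m n : ℕ} {S : ℤ → Prop} (h : Good M m n S) : Good M n m S := by
  obtain ⟨A, h1, h2, h3⟩ := h
  refine ⟨fun i j => A j i, h2, h1, fun v hv hs => ?_⟩
  obtain ⟨i, j, hij⟩ := h3 v hv hs
  exact ⟨j, i, hij⟩

theorem Good.hcat {M : ℤ} {m n n' : ℕ} {S S' : ℤ → Prop} (h : Good M m n S)
    (h' : Good M m n' S') : Good M m (n + n') (fun v => S v ∨ S' v) := by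
  obtain ⟨A, h1, h2, h3⟩ := h
  obtain ⟨B, k1, k2, k3⟩ := h'
  refine ⟨fun i => Fin.append (A i) (B i), fun i => ?_, fun j => ?_, fun v hv hs => ?_⟩
  · rw [Fin.sum_univ_add]
    simpa using dvd_add (h1 i) (k1 i)
  · refine Fin.addCases (fun j => ?_) (fun j => ?_) j
    · simpa using h2 j
    · simpa using k2 j
  · rcases hs with hs | hs
    · obtain ⟨i, j, hij⟩ := h3 v hv hs
      exact ⟨i, Fin.castAdd _ j, by simpa using hij⟩
    · obtain ⟨i, j, hij⟩ := k3 v hv hs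
      exact ⟨i, Fin.natAdd _ j, by simpa using hij⟩

theorem Good.vcat {M : ℤ} {m m' n : ℕ} {S S' : ℤ → Prop} (h : Good M m n S)
    (h' : Good M m' n S') : Good M (m + m') n (fun v => S v ∨ S' v) :=
  (h.trans.hcat h'.trans).trans

theorem Good.empty_right (M : ℤ) (m : ℕ) : Good M m 0 (fun _ => False) :=
  ⟨fun _ j => j.elim0, fun i => by simp, fun j => j.elim0, fun _ _ h => h.elim⟩

/-- Counting: a `Good` array covering `1, …, mn` is a tight Heffter array. -/
theorem Good.final {m n : ℕ}
    (h : Good (2 * ((m : ℤ) * n) + 1) m n (fun v => v ≤ m * n)) :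
    ∃ A : Fin m → Fin n → ℤ,
      (∀ i, (2 * (m : ℤ) * n + 1) ∣ ∑ j, A i j) ∧
      (∀ j, (2 * (m : ℤ) * n + 1) ∣ ∑ i, A i j) ∧
      (∀ v ∈ Finset.Icc (1 : ℤ) (m * n), ∃! p : Fin m × Fin n, |A p.1 p.2| = v) := by
  obtain ⟨A, h1, h2, h3⟩ := h
  refine ⟨A, by simpa [mul_assoc] using h1, by simpa [mul_assoc] using h2, ?_⟩
  have hcov : ∀ v ∈ Finset.Icc (1 : ℤ) (m * n), ∃ p : Fin m × Fin n, |A p.1 p.2| = v := by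
    intro v hv
    rw [Finset.mem_Icc] at hv
    obtain ⟨i, j, hij⟩ := h3 v (by omega) hv.2
    refine ⟨(i, j), ?_⟩
    rcases hij with h | h <;> simp only [h, abs_neg] <;> exact abs_of_pos (by omega)
  have hsub : Finset.Icc (1 : ℤ) (m * n) ⊆
      Finset.univ.image (fun p : Fin m × Fin n => |A p.1 p.2|) := by
    intro v hv
    obtain ⟨p, hp⟩ := hcov v hv
    exact Finset.mem_image.2 ⟨p, Finset.mem_univ _, hp⟩
  have hcard : (Finset.univ.image (fun p : Fin m × Fin n => |A p.1 p.2|)).card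
      = (Finset.univ : Finset (Fin m × Fin n)).card := by
    apply le_antisymm Finset.card_image_le
    have := Finset.card_le_card hsub
    have e : (Finset.Icc (1 : ℤ) (m * n)).card = m * n := by
      rw [Int.card_Icc]
      have : ((m : ℤ) * n + 1 - 1) = ((m * n : ℕ) : ℤ) := by push_cast; ring
      rw [this, Int.toNat_natCast]
    simpa [e] using this
  have hinj := Finset.card_image_iff.1 hcard
  intro v hv
  obtain ⟨p, hp⟩ := hcov v hv
  exact ⟨p, hp, fun q hq => hinj (by simp) (by simp) (hq.trans hp.symm)⟩

/-! ### Even by even filler -/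

/-- An `a × b` array with zero sums whose entries cover an arbitrary interval of length `ab`. -/
def Fill (a b : ℕ) : Prop := ∀ M s : ℤ, Good M a b (fun v => s < v ∧ v ≤ s + a * b)

theorem Fill.trans {a b : ℕ} (h : Fill a b) : Fill b a := fun M s =>
  (h M s).trans.mono fun v _ hv => by rwa [mul_comm] at hv

theorem Fill.vcat {a a' b : ℕ} (h : Fill a b) (h' : Fill a' b) : Fill (a + a') b := fun M s =>
  ((h M s).vcat (h' M (s + a * b))).mono fun v _ hv => by
    push_cast at hv
    by_cases hc : v ≤ s + a * b
    · exact Or.inl ⟨hv.1, hc⟩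
    · exact Or.inr ⟨by omega, by linarith [hv.2]⟩

theorem fill44 : Fill 4 4 := fun M s => by
  refine ⟨![![s+14, -(s+15), s+3, -(s+2)], ![-(s+8), s+11, -(s+9), s+6],
    ![s+7, -(s+12), s+10, -(s+5)], ![-(s+13), s+16, -(s+4), s+1]], ?_, ?_, ?_⟩
  · intro i; fin_cases i <;> refine ⟨0, ?_⟩ <;> simp [Fin.sum_univ_succ] <;> ring
  · intro i; fin_cases i <;> refine ⟨0, ?_⟩ <;> simp [Fin.sum_univ_succ] <;> ring
  · rintro v hv ⟨h1, h2⟩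
    change MatCov _ v
    simp only [matCov_cons, matCov_nil, rowCov_cons, rowCov_nil, or_false]
    push_cast at h2
    omega

theorem fill46 : Fill 4 6 := fun M s => by
  refine ⟨![![s+2, -(s+3), s+10, -(s+8), s+19, -(s+20)],
    ![-(s+4), s+12, -(s+22), s+11, -(s+21), s+24],
    ![s+17, -(s+23), s+18, -(s+16), s+9, -(s+5)],
    ![-(s+15), s+14, -(s+6), s+13, -(s+7), s+1]], ?_, ?_, ?_⟩
  · intro i; fin_cases i <;> refine ⟨0, ?_⟩ <;> simp [Fin.sum_univ_succ] <;> ring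
  · intro i; fin_cases i <;> refine ⟨0, ?_⟩ <;> simp [Fin.sum_univ_succ] <;> ring
  · rintro v hv ⟨h1, h2⟩
    change MatCov _ v
    simp only [matCov_cons, matCov_nil, rowCov_cons, rowCov_nil, or_false]
    push_cast at h2
    omega

theorem fill66 : Fill 6 6 := fun M s => by
  refine ⟨![![s+10, s+36, s+22, -(s+28), -(s+7), -(s+33)],
    ![s+18, s+16, -(s+26), -(s+5), -(s+32), s+29],
    ![s+4, -(s+20), -(s+11), -(s+13), s+31, s+9],
    ![-(s+6), -(s+21), -(s+23), s+1, s+25, s+24],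
    ![-(s+14), -(s+19), s+3, s+15, s+17, -(s+2)],
    ![-(s+12), s+8, s+35, s+30, -(s+34), -(s+27)]], ?_, ?_, ?_⟩
  · intro i; fin_cases i <;> refine ⟨0, ?_⟩ <;> simp [Fin.sum_univ_succ] <;> ring
  · intro i; fin_cases i <;> refine ⟨0, ?_⟩ <;> simp [Fin.sum_univ_succ] <;> ring
  · rintro v hv ⟨h1, h2⟩
    change MatCov _ v
    simp only [matCov_cons, matCov_nil, rowCov_cons, rowCov_nil, or_false]
    push_cast at h2
    omega

theorem fill_zero (b : ℕ) : Fill 0 b := fun M s =>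
  (Good.empty_right M b).trans.mono fun v _ hv => by
    simp only [Nat.cast_zero, zero_mul, add_zero] at hv
    omega

/-- Extend a filler of height 4 or 6 to any admissible even height. -/
theorem fill_rows {b : ℕ} (h4 : Fill 4 b) (h6 : Fill 6 b) :
    ∀ a : ℕ, Even a → a ≠ 2 → Fill a b := by
  intro a
  induction a using Nat.strong_induction_on with
  | _ a ih =>
    intro he h2
    by_cases h0 : a = 0
    · subst h0; exact fill_zero b
    by_cases h44 : a = 4
    · subst h44; exact h4
    by_cases h66 : a = 6
    · subst h66; exact h6
    obtain ⟨k, hk⟩ := he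
    have := ih (a - 4) (by omega) ⟨k - 2, by omega⟩ (by omega)
    have h := this.vcat h4
    rwa [show a - 4 + 4 = a by omega] at h

theorem fill_even (a b : ℕ) (ha : Even a) (hb : Even b) (ha2 : a ≠ 2) (hb2 : b ≠ 2) :
    Fill a b :=
  fill_rows (fill_rows fill44 fill46.trans b hb hb2).trans
    (fill_rows fill46 fill66 b hb hb2).trans a ha ha2

/-! ### Chunks of four columns -/

/-- The values in a chunk: four columns of height three. -/
def chunkS (b dB a dA h v : ℤ) : Prop :=
  v = dA ∨ v = dA - 2 * h ∨ v = dB ∨ v = dB - 2 * h ∨ v = a ∨ v = a + h ∨ v = b ∨ v = b + h ∨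
    v = a + dA ∨ v = a + dA - h ∨ v = b + dB ∨ v = b + dB - h

theorem chunk (M b dB a dA h : ℤ) : Good M 3 4 (chunkS b dB a dA h) := by
  refine ⟨![![dA, -(dA - 2 * h), -dB, dB - 2 * h], ![a, -(a + h), -b, b + h],
    ![-(a + dA), a + dA - h, b + dB, -(b + dB - h)]], ?_, ?_, ?_⟩
  · intro i; fin_cases i <;> refine ⟨0, ?_⟩ <;> simp [Fin.sum_univ_succ] <;> ring
  · intro i; fin_cases i <;> refine ⟨0, ?_⟩ <;> simp [Fin.sum_univ_succ] <;> ring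
  · rintro v hv hs
    change MatCov _ v
    simp only [matCov_cons, matCov_nil, rowCov_cons, rowCov_nil, or_false]
    rcases hs with e | e | e | e | e | e | e | e | e | e | e | e <;>
      simp only [e, true_or, or_true]

theorem strip (M b dB a dA h : ℤ) (x : ℕ) : Good M 3 (4 * x) (fun v => ∃ c : ℤ, 0 ≤ c ∧ c < x ∧
    chunkS (b + c) (dB - 2 * c) (a + c) (dA - 2 * c) h v) := by
  induction x with
  | zero =>
    refine (Good.empty_right M 3).mono ?_
    rintro v - ⟨c, h0, h1, -⟩
    simp only [Nat.cast_zero] at h1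
    omega
  | succ x ih =>
    refine (ih.hcat (chunk M (b + x) (dB - 2 * x) (a + x) (dA - 2 * x) h)).mono ?_
    rintro v - ⟨c, h0, h1, hc⟩
    push_cast at h1
    rcases lt_or_eq_of_le (show c ≤ x by omega) with hlt | rfl
    · exact Or.inl ⟨c, h0, hlt, hc⟩
    · exact Or.inr hc

/-- The values in a chunk of height five. -/
def chunk5S (e u b dB a dA h v : ℤ) : Prop :=
  v = dA - e ∨ v = dA - 2 * h - e ∨ v = dB + e ∨ v = dB - 2 * h + e ∨
    v = a ∨ v = a + h ∨ v = b ∨ v = b + h ∨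
    v = a + dA ∨ v = a + dA - h ∨ v = b + dB ∨ v = b + dB - h ∨ (u < v ∧ v ≤ u + 8)

theorem chunk5 (M e u b dB a dA h : ℤ) (he : e = 1 ∨ e = -1) :
    Good M 5 4 (chunk5S e u b dB a dA h) := by
  refine ⟨![![dA - e, -(dA - 2 * h - e), -(dB + e), dB - 2 * h + e], ![a, -(a + h), -b, b + h],
    ![-(a + dA), a + dA - h, b + dB, -(b + dB - h)],
    ![e * (u + 2), -(e * (u + 4)), -(e * (u + 5)), e * (u + 7)],
    ![-(e * (u + 1)), e * (u + 3), e * (u + 6), -(e * (u + 8))]], ?_, ?_, ?_⟩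
  · intro i; fin_cases i <;> refine ⟨0, ?_⟩ <;> simp [Fin.sum_univ_succ] <;> ring
  · intro i; fin_cases i <;> refine ⟨0, ?_⟩ <;> simp [Fin.sum_univ_succ] <;> ring
  · rintro v hv hs
    change MatCov _ v
    simp only [matCov_cons, matCov_nil, rowCov_cons, rowCov_nil, or_false]
    rcases hs with k | k | k | k | k | k | k | k | k | k | k | k | ⟨h1, h2⟩
    iterate 12 simp only [k, true_or, or_true]
    have hk : v = u + 1 ∨ v = u + 2 ∨ v = u + 3 ∨ v = u + 4 ∨ v = u + 5 ∨ v = u + 6 ∨ v = u + 7 ∨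
      v = u + 8 := by omega
    rcases he with rfl | rfl <;> rcases hk with k | k | k | k | k | k | k | k <;>
      simp only [k, one_mul, neg_mul, neg_neg, true_or, or_true]

theorem strip5 (M e u b dB a dA h : ℤ) (he : e = 1 ∨ e = -1) (x : ℕ) :
    Good M 5 (4 * x) (fun v => ∃ c : ℤ, 0 ≤ c ∧ c < x ∧
      chunk5S e (u + 8 * c) (b + c) (dB - 2 * c) (a + c) (dA - 2 * c) h v) := by
  induction x with
  | zero =>
    refine (Good.empty_right M 5).mono ?_
    rintro v - ⟨c, h0, h1, -⟩
    simp only [Nat.cast_zero] at h1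
    omega
  | succ x ih =>
    refine (ih.hcat (chunk5 M e (u + 8 * x) (b + x) (dB - 2 * x) (a + x) (dA - 2 * x) h he)).mono ?_
    rintro v - ⟨c, h0, h1, hc⟩
    push_cast at h1
    rcases lt_or_eq_of_le (show c ≤ x by omega) with hlt | rfl
    · exact Or.inl ⟨c, h0, hlt, hc⟩
    · exact Or.inr hc

/-! ### Families of chunks -/

def fam (b dB a dA h x v : ℤ) : Prop :=
  ∃ c : ℤ, 0 ≤ c ∧ c < x ∧ chunkS (b + c) (dB - 2 * c) (a + c) (dA - 2 * c) h v

def fam5 (e u b dB a dA h x v : ℤ) : Prop :=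
  ∃ c : ℤ, 0 ≤ c ∧ c < x ∧
    chunk5S e (u + 8 * c) (b + c) (dB - 2 * c) (a + c) (dA - 2 * c) h v

theorem not_fam {b dB a dA h x v : ℤ} (hn : ¬ fam b dB a dA h x v) :
    ¬ (dA - 2 * x < v ∧ v ≤ dA ∧ (dA - v) % 2 = 0) ∧
    ¬ (dA - 2 * h - 2 * x < v ∧ v ≤ dA - 2 * h ∧ (dA - v) % 2 = 0) ∧
    ¬ (dB - 2 * x < v ∧ v ≤ dB ∧ (dB - v) % 2 = 0) ∧
    ¬ (dB - 2 * h - 2 * x < v ∧ v ≤ dB - 2 * h ∧ (dB - v) % 2 = 0) ∧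
    ¬ (a ≤ v ∧ v < a + x) ∧ ¬ (a + h ≤ v ∧ v < a + h + x) ∧
    ¬ (b ≤ v ∧ v < b + x) ∧ ¬ (b + h ≤ v ∧ v < b + h + x) ∧
    ¬ (a + dA - x < v ∧ v ≤ a + dA) ∧ ¬ (a + dA - h - x < v ∧ v ≤ a + dA - h) ∧
    ¬ (b + dB - x < v ∧ v ≤ b + dB) ∧ ¬ (b + dB - h - x < v ∧ v ≤ b + dB - h) := by
  have f : ∀ c, 0 ≤ c → c < x → ¬ chunkS (b + c) (dB - 2 * c) (a + c) (dA - 2 * c) h v :=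
    fun c h0 h1 hc => hn ⟨c, h0, h1, hc⟩
  simp only [chunkS, not_or] at f
  refine ⟨fun hh => ?_, fun hh => ?_, fun hh => ?_, fun hh => ?_, fun hh => ?_, fun hh => ?_,
    fun hh => ?_, fun hh => ?_, fun hh => ?_, fun hh => ?_, fun hh => ?_, fun hh => ?_⟩
  · have := (f ((dA - v) / 2) (by omega) (by omega)).1; omega
  · have := (f ((dA - 2 * h - v) / 2) (by omega) (by omega)).2.1; omega
  · have := (f ((dB - v) / 2) (by omega) (by omega)).2.2.1; omega
  · have := (f ((dB - 2 * h - v) / 2) (by omega) (by omega)).2.2.2.1; omega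
  · have := (f (v - a) (by omega) (by omega)).2.2.2.2.1; omega
  · have := (f (v - a - h) (by omega) (by omega)).2.2.2.2.2.1; omega
  · have := (f (v - b) (by omega) (by omega)).2.2.2.2.2.2.1; omega
  · have := (f (v - b - h) (by omega) (by omega)).2.2.2.2.2.2.2.1; omega
  · have := (f (a + dA - v) (by omega) (by omega)).2.2.2.2.2.2.2.2.1; omega
  · have := (f (a + dA - h - v) (by omega) (by omega)).2.2.2.2.2.2.2.2.2.1; omega
  · have := (f (b + dB - v) (by omega) (by omega)).2.2.2.2.2.2.2.2.2.2.1; omega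
  · have := (f (b + dB - h - v) (by omega) (by omega)).2.2.2.2.2.2.2.2.2.2.2; omega

theorem not_fam5 {e u b dB a dA h x v : ℤ} (hn : ¬ fam5 e u b dB a dA h x v)
    (_he : e = 1 ∨ e = -1) :
    ¬ (dA - e - 2 * x < v ∧ v ≤ dA - e ∧ (dA - e - v) % 2 = 0) ∧
    ¬ (dA - e - 2 * h - 2 * x < v ∧ v ≤ dA - e - 2 * h ∧ (dA - e - v) % 2 = 0) ∧
    ¬ (dB + e - 2 * x < v ∧ v ≤ dB + e ∧ (dB + e - v) % 2 = 0) ∧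
    ¬ (dB + e - 2 * h - 2 * x < v ∧ v ≤ dB + e - 2 * h ∧ (dB + e - v) % 2 = 0) ∧
    ¬ (a ≤ v ∧ v < a + x) ∧ ¬ (a + h ≤ v ∧ v < a + h + x) ∧
    ¬ (b ≤ v ∧ v < b + x) ∧ ¬ (b + h ≤ v ∧ v < b + h + x) ∧
    ¬ (a + dA - x < v ∧ v ≤ a + dA) ∧ ¬ (a + dA - h - x < v ∧ v ≤ a + dA - h) ∧
    ¬ (b + dB - x < v ∧ v ≤ b + dB) ∧ ¬ (b + dB - h - x < v ∧ v ≤ b + dB - h) := by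
  have f : ∀ c, 0 ≤ c → c < x →
      ¬ chunk5S e (u + 8 * c) (b + c) (dB - 2 * c) (a + c) (dA - 2 * c) h v :=
    fun c h0 h1 hc => hn ⟨c, h0, h1, hc⟩
  simp only [chunk5S, not_or] at f
  refine ⟨fun hh => ?_, fun hh => ?_, fun hh => ?_, fun hh => ?_, fun hh => ?_, fun hh => ?_,
    fun hh => ?_, fun hh => ?_, fun hh => ?_, fun hh => ?_, fun hh => ?_, fun hh => ?_⟩
  · have := (f ((dA - e - v) / 2) (by omega) (by omega)).1; omega
  · have := (f ((dA - e - 2 * h - v) / 2) (by omega) (by omega)).2.1; omega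
  · have := (f ((dB + e - v) / 2) (by omega) (by omega)).2.2.1; omega
  · have := (f ((dB + e - 2 * h - v) / 2) (by omega) (by omega)).2.2.2.1; omega
  · have := (f (v - a) (by omega) (by omega)).2.2.2.2.1; omega
  · have := (f (v - a - h) (by omega) (by omega)).2.2.2.2.2.1; omega
  · have := (f (v - b) (by omega) (by omega)).2.2.2.2.2.2.1; omega
  · have := (f (v - b - h) (by omega) (by omega)).2.2.2.2.2.2.2.1; omega
  · have := (f (a + dA - v) (by omega) (by omega)).2.2.2.2.2.2.2.2.1; omega
  · have := (f (a + dA - h - v) (by omega) (by omega)).2.2.2.2.2.2.2.2.2.1; omega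
  · have := (f (b + dB - v) (by omega) (by omega)).2.2.2.2.2.2.2.2.2.2.1; omega
  · have := (f (b + dB - h - v) (by omega) (by omega)).2.2.2.2.2.2.2.2.2.2.2.1; omega

/-! ### Cores -/

theorem core6 (N t : ℤ) (_ht : 0 ≤ t) : Good (2 * N + 1) 3 6 (fun v =>
    (v ≤ 4 * t + 6 ∨ (N - 8 * t - 12 < v ∧ v ≤ N)) ∧
    ¬ fam (N - 8 * t - 11) (4 * t + 3) (N - 4 * t - 4) (4 * t + 4) (t + 1) t v) := by
  refine ⟨![![4 * t + 6, -(4 * t + 5), N - 6 * t - 10, 2 * t + 3, -(N - 4 * t - 5), 1],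
    ![N - 6 * t - 9, -(N - 3 * t - 4), -(N - 4 * t - 6), -(N - 5 * t - 8), N - 4 * t - 7, N - 2 * t - 2],
    ![-(N - 2 * t - 3), -(N - t), 2 * t + 4, N - 7 * t - 11, 2, -(N - 2 * t - 1)]], ?_, ?_, ?_⟩
  · refine fun i => ⟨(![0, 0, -1] : Fin 3 → ℤ) i, ?_⟩
    fin_cases i <;> simp [Fin.sum_univ_succ] <;> ring
  · refine fun i => ⟨(![0, -1, 0, 0, 0, 0] : Fin 6 → ℤ) i, ?_⟩
    fin_cases i <;> simp [Fin.sum_univ_succ] <;> ring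
  · rintro v hv ⟨hr, hn⟩
    obtain ⟨f1, f2, f3, f4, g1, g2, g3, g4, g5, g6, g7, g8⟩ := not_fam hn
    change MatCov _ v
    simp only [matCov_cons, matCov_nil, rowCov_cons, rowCov_nil, or_false]
    rcases hr with hr | hr
    · clear g1 g2 g3 g4 g5 g6 g7 g8
      have hd : v = 1 ∨ v = 2 ∨ v = 2 * t + 3 ∨ v = 2 * t + 4 ∨ v = 4 * t + 5 ∨ v = 4 * t + 6 := by
        omega
      rcases hd with e | e | e | e | e | e <;> simp only [e, true_or, or_true]
    · clear f1 f2 f3 f4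
      have hd : v = N - 7 * t - 11 ∨ v = N - 6 * t - 10 ∨ v = N - 6 * t - 9 ∨ v = N - 5 * t - 8 ∨
      v = N - 4 * t - 7 ∨ v = N - 4 * t - 6 ∨ v = N - 4 * t - 5 ∨ v = N - 3 * t - 4 ∨
      v = N - 2 * t - 3 ∨ v = N - 2 * t - 2 ∨ v = N - 2 * t - 1 ∨ v = N - t := by
        omega
      rcases hd with e | e | e | e | e | e | e | e | e | e | e | e <;>
        simp only [e, true_or, or_true]

theorem core7 (N t : ℤ) (_ht : 0 ≤ t) : Good (2 * N + 1) 3 7 (fun v =>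
    (v ≤ 4 * t + 7 ∨ (N - 8 * t - 14 < v ∧ v ≤ N)) ∧
    ¬ fam (N - 8 * t - 13) (4 * t + 5) (N - 4 * t - 5) (4 * t + 4) (t + 1) t v) := by
  refine ⟨![![4 * t + 7, 4 * t + 6, 2 * t + 5, N - 4 * t - 7, 3, -2, N - 6 * t - 11],
    ![N - 3 * t - 5, -N, N - 7 * t - 13, -(N - 2 * t - 3), -(N - 6 * t - 9), -(N - 2 * t - 4), 1],
    ![N - t - 1, N - 4 * t - 6, -(N - 5 * t - 8), 2 * t + 4, N - 6 * t - 12, N - 2 * t - 2, -(N - 6 * t - 10)]], ?_, ?_, ?_⟩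
  · refine fun i => ⟨(![1, -1, 1] : Fin 3 → ℤ) i, ?_⟩
    fin_cases i <;> simp [Fin.sum_univ_succ] <;> ring
  · refine fun i => ⟨(![1, 0, 0, 0, 0, 0, 0] : Fin 7 → ℤ) i, ?_⟩
    fin_cases i <;> simp [Fin.sum_univ_succ] <;> ring
  · rintro v hv ⟨hr, hn⟩
    obtain ⟨f1, f2, f3, f4, g1, g2, g3, g4, g5, g6, g7, g8⟩ := not_fam hn
    change MatCov _ v
    simp only [matCov_cons, matCov_nil, rowCov_cons, rowCov_nil, or_false]
    rcases hr with hr | hr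
    · clear g1 g2 g3 g4 g5 g6 g7 g8
      have hd : v = 1 ∨ v = 2 ∨ v = 3 ∨ v = 2 * t + 4 ∨ v = 2 * t + 5 ∨ v = 4 * t + 6 ∨ v = 4 * t + 7 := by
        omega
      rcases hd with e | e | e | e | e | e | e <;> simp only [e, true_or, or_true]
    · clear f1 f2 f3 f4
      have hd : v = N - 7 * t - 13 ∨ v = N - 6 * t - 12 ∨ v = N - 6 * t - 11 ∨ v = N - 6 * t - 10 ∨
      v = N - 6 * t - 9 ∨ v = N - 5 * t - 8 ∨ v = N - 4 * t - 7 ∨ v = N - 4 * t - 6 ∨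
      v = N - 3 * t - 5 ∨ v = N - 2 * t - 4 ∨ v = N - 2 * t - 3 ∨ v = N - 2 * t - 2 ∨
      v = N - t - 1 ∨ v = N := by
        omega
      rcases hd with e | e | e | e | e | e | e | e | e | e | e | e | e | e <;>
        simp only [e, true_or, or_true]

theorem core8 (N t : ℤ) (_ht : 0 ≤ t) : Good (2 * N + 1) 3 8 (fun v =>
    (v ≤ 4 * t + 8 ∨ (N - 8 * t - 16 < v ∧ v ≤ N)) ∧
    ¬ fam (N - 8 * t - 15) (4 * t + 5) (N - 4 * t - 6) (4 * t + 6) (t + 1) t v) := by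
  refine ⟨![![4 * t + 8, 4 * t + 7, 2 * t + 6, 2 * t + 5, -4, N - 6 * t - 11, 2, N - 6 * t - 12],
    ![N - 2 * t - 4, N - 3 * t - 6, -(N - 2 * t - 2), N - 7 * t - 15, -(N - 2 * t - 5), -(N - 6 * t - 14), N - 4 * t - 9, -(N - 6 * t - 13)],
    ![N - 2 * t - 3, N - t, N - 4 * t - 8, -(N - 5 * t - 10), N - 2 * t - 1, -3, -(N - 4 * t - 7), -1]], ?_, ?_, ?_⟩
  · refine fun i => ⟨(![1, 0, 1] : Fin 3 → ℤ) i, ?_⟩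
    fin_cases i <;> simp [Fin.sum_univ_succ] <;> ring
  · refine fun i => ⟨(![1, 1, 0, 0, 0, 0, 0, 0] : Fin 8 → ℤ) i, ?_⟩
    fin_cases i <;> simp [Fin.sum_univ_succ] <;> ring
  · rintro v hv ⟨hr, hn⟩
    obtain ⟨f1, f2, f3, f4, g1, g2, g3, g4, g5, g6, g7, g8⟩ := not_fam hn
    change MatCov _ v
    simp only [matCov_cons, matCov_nil, rowCov_cons, rowCov_nil, or_false]
    rcases hr with hr | hr
    · clear g1 g2 g3 g4 g5 g6 g7 g8
      have hd : v = 1 ∨ v = 2 ∨ v = 3 ∨ v = 4 ∨ v = 2 * t + 5 ∨ v = 2 * t + 6 ∨ v = 4 * t + 7 ∨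
      v = 4 * t + 8 := by
        omega
      rcases hd with e | e | e | e | e | e | e | e <;> simp only [e, true_or, or_true]
    · clear f1 f2 f3 f4
      have hd : v = N - 7 * t - 15 ∨ v = N - 6 * t - 14 ∨ v = N - 6 * t - 13 ∨ v = N - 6 * t - 12 ∨
      v = N - 6 * t - 11 ∨ v = N - 5 * t - 10 ∨ v = N - 4 * t - 9 ∨ v = N - 4 * t - 8 ∨
      v = N - 4 * t - 7 ∨ v = N - 3 * t - 6 ∨ v = N - 2 * t - 5 ∨ v = N - 2 * t - 4 ∨
      v = N - 2 * t - 3 ∨ v = N - 2 * t - 2 ∨ v = N - 2 * t - 1 ∨ v = N - t := by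
        omega
      rcases hd with e | e | e | e | e | e | e | e | e | e | e | e | e | e | e | e <;>
        simp only [e, true_or, or_true]

theorem core9 (N t : ℤ) (_ht : 0 ≤ t) : Good (2 * N + 1) 3 9 (fun v =>
    (v ≤ 4 * t + 9 ∨ (N - 8 * t - 18 < v ∧ v ≤ N)) ∧
    ¬ fam (N - 8 * t - 17) (4 * t + 5) (N - 4 * t - 6) (4 * t + 6) (t + 1) t v) := by
  refine ⟨![![4 * t + 9, 4 * t + 8, 4 * t + 7, -(2 * t + 6), -(2 * t + 5), 4, N - 6 * t - 16, 2, N - 2 * t - 2],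
    ![N - 6 * t - 14, N - 2 * t - 4, N - 3 * t - 6, -(N - 6 * t - 15), -(N - 7 * t - 17), N - 4 * t - 11, -(N - 6 * t - 13), N - 4 * t - 10, 1],
    ![-(N - 2 * t - 5), N - 2 * t - 3, N - t, N - 4 * t - 9, N - 5 * t - 12, -(N - 4 * t - 7), 3, -(N - 4 * t - 8), -(N - 2 * t - 1)]], ?_, ?_, ?_⟩
  · refine fun i => ⟨(![1, 1, 0] : Fin 3 → ℤ) i, ?_⟩
    fin_cases i <;> simp [Fin.sum_univ_succ] <;> ring
  · refine fun i => ⟨(![0, 1, 1, 0, 0, 0, 0, 0, 0] : Fin 9 → ℤ) i, ?_⟩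
    fin_cases i <;> simp [Fin.sum_univ_succ] <;> ring
  · rintro v hv ⟨hr, hn⟩
    obtain ⟨f1, f2, f3, f4, g1, g2, g3, g4, g5, g6, g7, g8⟩ := not_fam hn
    change MatCov _ v
    simp only [matCov_cons, matCov_nil, rowCov_cons, rowCov_nil, or_false]
    rcases hr with hr | hr
    · clear g1 g2 g3 g4 g5 g6 g7 g8
      have hd : v = 1 ∨ v = 2 ∨ v = 3 ∨ v = 4 ∨ v = 2 * t + 5 ∨ v = 2 * t + 6 ∨ v = 4 * t + 7 ∨
      v = 4 * t + 8 ∨ v = 4 * t + 9 := by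
        omega
      rcases hd with e | e | e | e | e | e | e | e | e <;> simp only [e, true_or, or_true]
    · clear f1 f2 f3 f4
      have hd : v = N - 7 * t - 17 ∨ v = N - 6 * t - 16 ∨ v = N - 6 * t - 15 ∨ v = N - 6 * t - 14 ∨
      v = N - 6 * t - 13 ∨ v = N - 5 * t - 12 ∨ v = N - 4 * t - 11 ∨ v = N - 4 * t - 10 ∨
      v = N - 4 * t - 9 ∨ v = N - 4 * t - 8 ∨ v = N - 4 * t - 7 ∨ v = N - 3 * t - 6 ∨
      v = N - 2 * t - 5 ∨ v = N - 2 * t - 4 ∨ v = N - 2 * t - 3 ∨ v = N - 2 * t - 2 ∨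
      v = N - 2 * t - 1 ∨ v = N - t := by
        omega
      rcases hd with e | e | e | e | e | e | e | e | e | e | e | e | e | e | e | e | e | e <;>
        simp only [e, true_or, or_true]

theorem core5_6 (N t : ℤ) (_ht : 0 ≤ t) : Good (2 * N + 1) 5 6 (fun v =>
    (v ≤ 4 * t + 18 ∨ (N - 8 * t - 12 < v ∧ v ≤ N)) ∧
    ¬ fam5 (1) (4 * t + 18) (N - 8 * t - 11) (4 * t + 3) (N - 4 * t - 4) (4 * t + 4) (t + 1) t v) := by
  refine ⟨![![-1, -(4 * t + 14), -(4 * t + 10), 2 * t + 4, 4 * t + 18, 2 * t + 3],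
    ![N - 4 * t - 5, N - 2 * t - 2, -(N - 6 * t - 9), -(N - 5 * t - 8), -(N - t), N - 6 * t - 10],
    ![-(N - 4 * t - 7), 4 * t + 13, -(4 * t + 5), -(4 * t + 16), -(4 * t + 6), -(N - 4 * t - 6)],
    ![4 * t + 7, 2, 4 * t + 9, N - 7 * t - 11, -(N - 3 * t - 4), -(4 * t + 11)],
    ![-(4 * t + 8), -(N - 2 * t - 1), N - 2 * t - 3, 4 * t + 15, -(4 * t + 17), 4 * t + 12]], ?_, ?_, ?_⟩
  · refine fun i => ⟨(![0, 0, -1, 0, 0] : Fin 5 → ℤ) i, ?_⟩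
    fin_cases i <;> simp [Fin.sum_univ_succ] <;> ring
  · refine fun i => ⟨(![0, 0, 0, 0, -1, 0] : Fin 6 → ℤ) i, ?_⟩
    fin_cases i <;> simp [Fin.sum_univ_succ] <;> ring
  · rintro v hv ⟨hr, hn⟩
    obtain ⟨f1, f2, f3, f4, g1, g2, g3, g4, g5, g6, g7, g8⟩ := not_fam5 hn (by norm_num)
    change MatCov _ v
    simp only [matCov_cons, matCov_nil, rowCov_cons, rowCov_nil, or_false]
    rcases hr with hr | hr
    · clear g1 g2 g3 g4 g5 g6 g7 g8
      rcases le_or_gt v (4 * t + 6) with hs | hs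
      · have hd : v = 1 ∨ v = 2 ∨ v = 2 * t + 3 ∨ v = 2 * t + 4 ∨ v = 4 * t + 5 ∨ v = 4 * t + 6 := by
          omega
        rcases hd with e | e | e | e | e | e <;> simp only [e, true_or, or_true]
      · have hd : v = 4 * t + 7 ∨ v = 4 * t + 8 ∨ v = 4 * t + 9 ∨ v = 4 * t + 10 ∨ v = 4 * t + 11 ∨
      v = 4 * t + 12 ∨ v = 4 * t + 13 ∨ v = 4 * t + 14 ∨ v = 4 * t + 15 ∨ v = 4 * t + 16 ∨
      v = 4 * t + 17 ∨ v = 4 * t + 18 := by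
          omega
        rcases hd with e | e | e | e | e | e | e | e | e | e | e | e <;>
          simp only [e, true_or, or_true]
    · clear f1 f2 f3 f4
      have hd : v = N - 7 * t - 11 ∨ v = N - 6 * t - 10 ∨ v = N - 6 * t - 9 ∨ v = N - 5 * t - 8 ∨
      v = N - 4 * t - 7 ∨ v = N - 4 * t - 6 ∨ v = N - 4 * t - 5 ∨ v = N - 3 * t - 4 ∨
      v = N - 2 * t - 3 ∨ v = N - 2 * t - 2 ∨ v = N - 2 * t - 1 ∨ v = N - t := by
        omega
      rcases hd with e | e | e | e | e | e | e | e | e | e | e | e <;>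
        simp only [e, true_or, or_true]

theorem core5_7 (N t : ℤ) (_ht : 0 ≤ t) : Good (2 * N + 1) 5 7 (fun v =>
    (v ≤ 4 * t + 21 ∨ (N - 8 * t - 14 < v ∧ v ≤ N)) ∧
    ¬ fam5 (-1) (4 * t + 21) (N - 8 * t - 13) (4 * t + 5) (N - 4 * t - 5) (4 * t + 4) (t + 1) t v) := by
  refine ⟨![![-(N - 6 * t - 11), N - 6 * t - 12, -(N - 2 * t - 4), 2 * t + 5, -(4 * t + 10), -(N - 4 * t - 7), -(4 * t + 6)],
    ![4 * t + 14, -(4 * t + 13), N - 2 * t - 3, -(N - 2 * t - 2), N - 7 * t - 13, 4 * t + 8, -(N - 3 * t - 5)],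
    ![-(4 * t + 15), 4 * t + 12, -2, 4 * t + 20, 4 * t + 11, -(4 * t + 7), -(4 * t + 19)],
    ![N - 6 * t - 9, 3, 4 * t + 17, -(4 * t + 21), -(N - 5 * t - 8), -N, -(N - t - 1)],
    ![-1, -(N - 6 * t - 10), -(4 * t + 16), N - 4 * t - 6, 2 * t + 4, -(4 * t + 9), 4 * t + 18]], ?_, ?_, ?_⟩
  · refine fun i => ⟨(![-1, 0, 0, -1, 0] : Fin 5 → ℤ) i, ?_⟩
    fin_cases i <;> simp [Fin.sum_univ_succ] <;> ring
  · refine fun i => ⟨(![0, 0, 0, 0, 0, -1, -1] : Fin 7 → ℤ) i, ?_⟩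
    fin_cases i <;> simp [Fin.sum_univ_succ] <;> ring
  · rintro v hv ⟨hr, hn⟩
    obtain ⟨f1, f2, f3, f4, g1, g2, g3, g4, g5, g6, g7, g8⟩ := not_fam5 hn (by norm_num)
    change MatCov _ v
    simp only [matCov_cons, matCov_nil, rowCov_cons, rowCov_nil, or_false]
    rcases hr with hr | hr
    · clear g1 g2 g3 g4 g5 g6 g7 g8
      rcases le_or_gt v (4 * t + 7) with hs | hs
      · have hd : v = 1 ∨ v = 2 ∨ v = 3 ∨ v = 2 * t + 4 ∨ v = 2 * t + 5 ∨ v = 4 * t + 6 ∨ v = 4 * t + 7 := by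
          omega
        rcases hd with e | e | e | e | e | e | e <;> simp only [e, true_or, or_true]
      · have hd : v = 4 * t + 8 ∨ v = 4 * t + 9 ∨ v = 4 * t + 10 ∨ v = 4 * t + 11 ∨ v = 4 * t + 12 ∨
      v = 4 * t + 13 ∨ v = 4 * t + 14 ∨ v = 4 * t + 15 ∨ v = 4 * t + 16 ∨ v = 4 * t + 17 ∨
      v = 4 * t + 18 ∨ v = 4 * t + 19 ∨ v = 4 * t + 20 ∨ v = 4 * t + 21 := by
          omega
        rcases hd with e | e | e | e | e | e | e | e | e | e | e | e | e | e <;>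
          simp only [e, true_or, or_true]
    · clear f1 f2 f3 f4
      have hd : v = N - 7 * t - 13 ∨ v = N - 6 * t - 12 ∨ v = N - 6 * t - 11 ∨ v = N - 6 * t - 10 ∨
      v = N - 6 * t - 9 ∨ v = N - 5 * t - 8 ∨ v = N - 4 * t - 7 ∨ v = N - 4 * t - 6 ∨
      v = N - 3 * t - 5 ∨ v = N - 2 * t - 4 ∨ v = N - 2 * t - 3 ∨ v = N - 2 * t - 2 ∨
      v = N - t - 1 ∨ v = N := by
        omega
      rcases hd with e | e | e | e | e | e | e | e | e | e | e | e | e | e <;>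
        simp only [e, true_or, or_true]

theorem core5_8 (N t : ℤ) (_ht : 0 ≤ t) : Good (2 * N + 1) 5 8 (fun v =>
    (v ≤ 4 * t + 24 ∨ (N - 8 * t - 16 < v ∧ v ≤ N)) ∧
    ¬ fam5 (1) (4 * t + 24) (N - 8 * t - 15) (4 * t + 5) (N - 4 * t - 6) (4 * t + 6) (t + 1) t v) := by
  refine ⟨![![-4, 4 * t + 21, -(4 * t + 7), -(4 * t + 16), N - 6 * t - 12, -(N - 5 * t - 10), -(N - t), -(N - 4 * t - 7)],
    ![4 * t + 18, N - 6 * t - 11, -(4 * t + 20), 4 * t + 15, 4 * t + 14, -(4 * t + 24), 4 * t + 12, N - 2 * t - 3],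
    ![-(4 * t + 17), -1, -(N - 2 * t - 5), -(N - 4 * t - 8), -3, 4 * t + 23, -(4 * t + 11), -(2 * t + 5)],
    ![-(N - 2 * t - 4), -(4 * t + 22), 4 * t + 19, 2, -(N - 6 * t - 14), N - 7 * t - 15, -(N - 3 * t - 6), -(4 * t + 9)],
    ![N - 2 * t - 1, -(N - 6 * t - 13), -(N - 2 * t - 2), N - 4 * t - 9, -(4 * t + 13), 2 * t + 6, -(4 * t + 8), 4 * t + 10]], ?_, ?_, ?_⟩
  · refine fun i => ⟨(![-1, 1, -1, -1, 0] : Fin 5 → ℤ) i, ?_⟩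
    fin_cases i <;> simp [Fin.sum_univ_succ] <;> ring
  · refine fun i => ⟨(![0, 0, -1, 0, 0, 0, -1, 0] : Fin 8 → ℤ) i, ?_⟩
    fin_cases i <;> simp [Fin.sum_univ_succ] <;> ring
  · rintro v hv ⟨hr, hn⟩
    obtain ⟨f1, f2, f3, f4, g1, g2, g3, g4, g5, g6, g7, g8⟩ := not_fam5 hn (by norm_num)
    change MatCov _ v
    simp only [matCov_cons, matCov_nil, rowCov_cons, rowCov_nil, or_false]
    rcases hr with hr | hr
    · clear g1 g2 g3 g4 g5 g6 g7 g8
      rcases le_or_gt v (4 * t + 8) with hs | hs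
      · have hd : v = 1 ∨ v = 2 ∨ v = 3 ∨ v = 4 ∨ v = 2 * t + 5 ∨ v = 2 * t + 6 ∨ v = 4 * t + 7 ∨
      v = 4 * t + 8 := by
          omega
        rcases hd with e | e | e | e | e | e | e | e <;> simp only [e, true_or, or_true]
      · have hd : v = 4 * t + 9 ∨ v = 4 * t + 10 ∨ v = 4 * t + 11 ∨ v = 4 * t + 12 ∨ v = 4 * t + 13 ∨
      v = 4 * t + 14 ∨ v = 4 * t + 15 ∨ v = 4 * t + 16 ∨ v = 4 * t + 17 ∨ v = 4 * t + 18 ∨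
      v = 4 * t + 19 ∨ v = 4 * t + 20 ∨ v = 4 * t + 21 ∨ v = 4 * t + 22 ∨ v = 4 * t + 23 ∨
      v = 4 * t + 24 := by
          omega
        rcases hd with e | e | e | e | e | e | e | e | e | e | e | e | e | e | e | e <;>
          simp only [e, true_or, or_true]
    · clear f1 f2 f3 f4
      have hd : v = N - 7 * t - 15 ∨ v = N - 6 * t - 14 ∨ v = N - 6 * t - 13 ∨ v = N - 6 * t - 12 ∨
      v = N - 6 * t - 11 ∨ v = N - 5 * t - 10 ∨ v = N - 4 * t - 9 ∨ v = N - 4 * t - 8 ∨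
      v = N - 4 * t - 7 ∨ v = N - 3 * t - 6 ∨ v = N - 2 * t - 5 ∨ v = N - 2 * t - 4 ∨
      v = N - 2 * t - 3 ∨ v = N - 2 * t - 2 ∨ v = N - 2 * t - 1 ∨ v = N - t := by
        omega
      rcases hd with e | e | e | e | e | e | e | e | e | e | e | e | e | e | e | e <;>
        simp only [e, true_or, or_true]

theorem core5_9 (N t : ℤ) (_ht : 0 ≤ t) : Good (2 * N + 1) 5 9 (fun v =>
    (v ≤ 4 * t + 27 ∨ (N - 8 * t - 18 < v ∧ v ≤ N)) ∧
    ¬ fam5 (1) (4 * t + 27) (N - 8 * t - 17) (4 * t + 5) (N - 4 * t - 6) (4 * t + 6) (t + 1) t v) := by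
  refine ⟨![![N - 6 * t - 13, -(N - 2 * t - 1), 4 * t + 9, -(N - t), N - 4 * t - 10, -(N - 6 * t - 15), N - 7 * t - 17, 4 * t + 18, -3],
    ![-(4 * t + 16), -(4 * t + 12), 4 * t + 14, 4 * t + 11, 1, -(4 * t + 24), 4 * t + 22, N - 4 * t - 7, -(N - 4 * t - 11)],
    ![-4, -(4 * t + 7), N - 2 * t - 2, -(N - 3 * t - 6), -(4 * t + 26), 4 * t + 25, -(N - 5 * t - 12), 2 * t + 5, N - 4 * t - 9],
    ![4 * t + 17, 4 * t + 13, N - 2 * t - 5, -(4 * t + 8), -(N - 4 * t - 8), N - 6 * t - 14, 2 * t + 6, -(N - 2 * t - 3), -(4 * t + 20)],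
    ![-(N - 6 * t - 16), -(N - 2 * t - 4), -(4 * t + 15), -(4 * t + 10), 4 * t + 27, -2, -(4 * t + 23), -(4 * t + 19), 4 * t + 21]], ?_, ?_, ?_⟩
  · refine fun i => ⟨(![0, 0, 0, 0, -1] : Fin 5 → ℤ) i, ?_⟩
    fin_cases i <;> simp [Fin.sum_univ_succ] <;> ring
  · refine fun i => ⟨(![0, -1, 1, -1, 0, 0, 0, 0, 0] : Fin 9 → ℤ) i, ?_⟩
    fin_cases i <;> simp [Fin.sum_univ_succ] <;> ring
  · rintro v hv ⟨hr, hn⟩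
    obtain ⟨f1, f2, f3, f4, g1, g2, g3, g4, g5, g6, g7, g8⟩ := not_fam5 hn (by norm_num)
    change MatCov _ v
    simp only [matCov_cons, matCov_nil, rowCov_cons, rowCov_nil, or_false]
    rcases hr with hr | hr
    · clear g1 g2 g3 g4 g5 g6 g7 g8
      rcases le_or_gt v (4 * t + 9) with hs | hs
      · have hd : v = 1 ∨ v = 2 ∨ v = 3 ∨ v = 4 ∨ v = 2 * t + 5 ∨ v = 2 * t + 6 ∨ v = 4 * t + 7 ∨
      v = 4 * t + 8 ∨ v = 4 * t + 9 := by
          omega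
        rcases hd with e | e | e | e | e | e | e | e | e <;> simp only [e, true_or, or_true]
      · have hd : v = 4 * t + 10 ∨ v = 4 * t + 11 ∨ v = 4 * t + 12 ∨ v = 4 * t + 13 ∨ v = 4 * t + 14 ∨
      v = 4 * t + 15 ∨ v = 4 * t + 16 ∨ v = 4 * t + 17 ∨ v = 4 * t + 18 ∨ v = 4 * t + 19 ∨
      v = 4 * t + 20 ∨ v = 4 * t + 21 ∨ v = 4 * t + 22 ∨ v = 4 * t + 23 ∨ v = 4 * t + 24 ∨
      v = 4 * t + 25 ∨ v = 4 * t + 26 ∨ v = 4 * t + 27 := by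
          omega
        rcases hd with e | e | e | e | e | e | e | e | e | e | e | e | e | e | e | e | e | e <;>
          simp only [e, true_or, or_true]
    · clear f1 f2 f3 f4
      have hd : v = N - 7 * t - 17 ∨ v = N - 6 * t - 16 ∨ v = N - 6 * t - 15 ∨ v = N - 6 * t - 14 ∨
      v = N - 6 * t - 13 ∨ v = N - 5 * t - 12 ∨ v = N - 4 * t - 11 ∨ v = N - 4 * t - 10 ∨
      v = N - 4 * t - 9 ∨ v = N - 4 * t - 8 ∨ v = N - 4 * t - 7 ∨ v = N - 3 * t - 6 ∨
      v = N - 2 * t - 5 ∨ v = N - 2 * t - 4 ∨ v = N - 2 * t - 3 ∨ v = N - 2 * t - 2 ∨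
      v = N - 2 * t - 1 ∨ v = N - t := by
        omega
      rcases hd with e | e | e | e | e | e | e | e | e | e | e | e | e | e | e | e | e | e <;>
        simp only [e, true_or, or_true]

theorem core15 (N t : ℤ) (_ht : 0 ≤ t) : ∃ S S' : ℤ → Prop,
    Good (2 * N + 1) 3 9 S ∧ Good (2 * N + 1) 3 6 S' ∧ ∀ v, 0 < v →
    (v ≤ 4 * t + 15 ∨ (N - 8 * t - 30 < v ∧ v ≤ N)) →
    ¬ fam (N - 8 * t - 29) (4 * t + 13) (N - 4 * t - 13) (4 * t + 12) (t + 3) t v → S v ∨ S' v := by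
  refine ⟨_, _, ⟨![![4 * t + 15, 4 * t + 14, 2 * t + 8, N - 6 * t - 24, N - 6 * t - 23, -(N - 2 * t - 10), 5, -(2 * t + 10), -(N - 2 * t - 5)],
    ![N - 3 * t - 11, N - 4 * t - 14, N - 4 * t - 15, 3, -(N - 6 * t - 22), -6, -(N - 6 * t - 20), N - t - 2, 4],
    ![N - t - 3, -N, -(N - 2 * t - 7), -(N - 6 * t - 21), 1, N - 2 * t - 4, N - 6 * t - 25, -(N - 3 * t - 12), N - 2 * t - 9]], ?_, ?_, fun v _ h => h⟩,
    ⟨![![2 * t + 9, -2, -(2 * t + 13), 7, -(2 * t + 12), 2 * t + 11],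
    ![N - 7 * t - 27, -(N - 2 * t - 8), -(N - 7 * t - 29), N - 6 * t - 26, N - t - 1, -(N - 5 * t - 17)],
    ![-(N - 5 * t - 18), N - 2 * t - 6, N - 5 * t - 16, -(N - 6 * t - 19), -(N - 3 * t - 13), N - 7 * t - 28]], ?_, ?_, fun v _ h => h⟩, ?_⟩
  · refine fun i => ⟨(![0, 1, 0] : Fin 3 → ℤ) i, ?_⟩
    fin_cases i <;> simp [Fin.sum_univ_succ] <;> ring
  · refine fun i => ⟨(![1, 0, 0, 0, 0, 0, 0, 0, 0] : Fin 9 → ℤ) i, ?_⟩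
    fin_cases i <;> simp [Fin.sum_univ_succ] <;> ring
  · refine fun i => ⟨(![0, 0, 0] : Fin 3 → ℤ) i, ?_⟩
    fin_cases i <;> simp [Fin.sum_univ_succ] <;> ring
  · refine fun i => ⟨(![0, 0, 0, 0, 0, 0] : Fin 6 → ℤ) i, ?_⟩
    fin_cases i <;> simp [Fin.sum_univ_succ] <;> ring
  · intro v hv hr hn
    obtain ⟨f1, f2, f3, f4, g1, g2, g3, g4, g5, g6, g7, g8⟩ := not_fam hn
    change MatCov _ v ∨ MatCov _ v
    simp only [matCov_cons, matCov_nil, rowCov_cons, rowCov_nil, or_false]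
    rcases hr with hr | hr
    · clear g1 g2 g3 g4 g5 g6 g7 g8
      have hd : v = 1 ∨ v = 2 ∨ v = 3 ∨ v = 4 ∨ v = 5 ∨ v = 6 ∨ v = 7 ∨ v = 2 * t + 8 ∨ v = 2 * t + 9 ∨
      v = 2 * t + 10 ∨ v = 2 * t + 11 ∨ v = 2 * t + 12 ∨ v = 2 * t + 13 ∨ v = 4 * t + 14 ∨
      v = 4 * t + 15 := by
        omega
      rcases hd with e | e | e | e | e | e | e | e | e | e | e | e | e | e | e <;>
        simp only [e, true_or, or_true]
    · clear f1 f2 f3 f4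
      have hd : v = N - 7 * t - 29 ∨ v = N - 7 * t - 28 ∨ v = N - 7 * t - 27 ∨ v = N - 6 * t - 26 ∨
      v = N - 6 * t - 25 ∨ v = N - 6 * t - 24 ∨ v = N - 6 * t - 23 ∨ v = N - 6 * t - 22 ∨
      v = N - 6 * t - 21 ∨ v = N - 6 * t - 20 ∨ v = N - 6 * t - 19 ∨ v = N - 5 * t - 18 ∨
      v = N - 5 * t - 17 ∨ v = N - 5 * t - 16 ∨ v = N - 4 * t - 15 ∨ v = N - 4 * t - 14 ∨
      v = N - 3 * t - 13 ∨ v = N - 3 * t - 12 ∨ v = N - 3 * t - 11 ∨ v = N - 2 * t - 10 ∨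
      v = N - 2 * t - 9 ∨ v = N - 2 * t - 8 ∨ v = N - 2 * t - 7 ∨ v = N - 2 * t - 6 ∨
      v = N - 2 * t - 5 ∨ v = N - 2 * t - 4 ∨ v = N - t - 3 ∨ v = N - t - 2 ∨ v = N - t - 1 ∨
      v = N := by
        omega
      rcases hd with e | e | e | e | e | e | e | e | e | e | e | e | e | e | e |
        e | e | e | e | e | e | e | e | e | e | e | e | e | e | e <;>
        simp only [e, true_or, or_true]


/-! ### Base cases -/

/-- A tight Heffter array, phrased with `Good`. -/
def HA (m n : ℕ) : Prop := Good (2 * ((m : ℤ) * n) + 1) m n (fun v => v ≤ m * n)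

theorem HA.trans {m n : ℕ} (h : HA m n) : HA n m := by
  have h' := Good.trans h
  rw [mul_comm (m : ℤ) n] at h'
  exact h'

theorem ha33 : HA 3 3 := by
  refine ⟨![![1, -5, 4], ![7, 3, 9], ![-8, 2, 6]], by decide, by decide, ?_⟩
  intro v hv hs
  change MatCov _ v
  simp only [matCov_cons, matCov_nil, rowCov_cons, rowCov_nil, or_false]
  push_cast at hs
  omega

theorem ha35 : HA 3 5 := by
  refine ⟨![![-6, 13, -2, 4, -9], ![-10, -1, 5, -11, -14], ![-15, -12, -3, 7, -8]],
    by decide, by decide, ?_⟩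
  intro v hv hs
  change MatCov _ v
  simp only [matCov_cons, matCov_nil, rowCov_cons, rowCov_nil, or_false]
  push_cast at hs
  omega

theorem ha54 : HA 5 4 := by
  refine ⟨![![-17, 2, -12, -14], ![-10, -18, 9, 19], ![3, -15, 5, 7], ![16, 20, 4, 1],
    ![8, 11, -6, -13]], by decide, by decide, ?_⟩
  intro v hv hs
  change MatCov _ v
  simp only [matCov_cons, matCov_nil, rowCov_cons, rowCov_nil, or_false]
  push_cast at hs
  omega

theorem ha55 : HA 5 5 := by
  refine ⟨![![-12, 10, -7, 20, -11], ![-18, 6, -21, -14, -4], ![-25, 15, -8, -24, -9],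
    ![1, -2, 13, -17, 5], ![3, 22, 23, -16, 19]], by decide, by decide, ?_⟩
  intro v hv hs
  change MatCov _ v
  simp only [matCov_cons, matCov_nil, rowCov_cons, rowCov_nil, or_false]
  push_cast at hs
  omega

theorem top4 (N : ℤ) : Good (2 * N + 1) 3 4 (fun v => v ≤ 4 ∨ (N - 8 < v ∧ v ≤ N)) := by
  refine ⟨![![4, N, N - 4, 1], ![N - 5, -3, 2, -(N - 6)],
    ![-(N - 1), -(N - 3), -(N - 2), N - 7]], ?_, ?_, ?_⟩
  · refine fun i => ⟨(![1, 0, -1] : Fin 3 → ℤ) i, ?_⟩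
    fin_cases i <;> simp [Fin.sum_univ_succ] <;> ring
  · refine fun i => ⟨(![0, 0, 0, 0] : Fin 4 → ℤ) i, ?_⟩
    fin_cases i <;> simp [Fin.sum_univ_succ] <;> ring
  · intro v hv hs
    change MatCov _ v
    simp only [matCov_cons, matCov_nil, rowCov_cons, rowCov_nil, or_false]
    omega

/-! ### Assembly -/

theorem fam_split {b dB a dA h v : ℤ} {x y : ℕ} (hf : fam b dB a dA h ((x : ℤ) + y) v) :
    fam b dB a dA h x v ∨ fam (b + x) (dB - 2 * x) (a + x) (dA - 2 * x) h y v := by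
  obtain ⟨c, h0, h1, hc⟩ := hf
  by_cases hx : c < x
  · exact Or.inl ⟨c, h0, hx, hc⟩
  · refine Or.inr ⟨c - x, by omega, by omega, ?_⟩
    have e1 : b + x + (c - x) = b + c := by ring
    have e2 : dB - 2 * x - 2 * (c - x) = dB - 2 * c := by ring
    have e3 : a + x + (c - x) = a + c := by ring
    have e4 : dA - 2 * x - 2 * (c - x) = dA - 2 * c := by ring
    rw [e1, e2, e3, e4]
    exact hc

/-- Distribute the chunks over a horizontal and a vertical arm. -/
theorem arms {M : ℤ} {k l : ℕ} {R S S' : ℤ → Prop} {b dB a dA h : ℤ} (x y : ℕ)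
    (hc : Good M 3 k S) (hc' : Good M 3 l S')
    (hR : ∀ v, 0 < v → R v → ¬ fam b dB a dA h ((x : ℤ) + y) v → S v ∨ S' v) :
    ∃ S1 S2, Good M 3 (k + 4 * x) S1 ∧ Good M 3 (l + 4 * y) S2 ∧
      ∀ v, 0 < v → R v → S1 v ∨ S2 v := by
  refine ⟨_, _, hc.hcat (strip M b dB a dA h x),
    hc'.hcat (strip M (b + x) (dB - 2 * x) (a + x) (dA - 2 * x) h y), fun v hv hr => ?_⟩
  by_cases hf : fam b dB a dA h ((x : ℤ) + y) v
  · rcases fam_split hf with h1 | h1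
    · exact Or.inl (Or.inr h1)
    · exact Or.inr (Or.inr h1)
  · rcases hR v hv hr hf with h1 | h1
    · exact Or.inl (Or.inl h1)
    · exact Or.inr (Or.inl h1)

theorem one_arm {M : ℤ} {k : ℕ} {R : ℤ → Prop} {b dB a dA h : ℤ} (x : ℕ)
    (hc : Good M 3 k (fun v => R v ∧ ¬ fam b dB a dA h x v)) : Good M 3 (k + 4 * x) R := by
  refine (hc.hcat (strip M b dB a dA h x)).mono fun v hv hr => ?_
  by_cases hf : fam b dB a dA h x v
  · exact Or.inr hf
  · exact Or.inl ⟨hr, hf⟩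

theorem one_arm5 {M L K : ℤ} {k : ℕ} {e u b dB a dA h : ℤ} (x : ℕ) (he : e = 1 ∨ e = -1)
    (hc : Good M 5 k (fun v => (v ≤ u ∨ (K < v ∧ v ≤ L)) ∧ ¬ fam5 e u b dB a dA h x v))
    (hK : K = u + 8 * x) :
    Good M 5 (k + 4 * x) (fun v => v ≤ L) := by
  refine (hc.hcat (strip5 M e u b dB a dA h he x)).mono fun v hv hr => ?_
  by_cases hf : fam5 e u b dB a dA h x v
  · exact Or.inr hf
  · refine Or.inl ⟨?_, hf⟩
    by_contra hcon
    refine hf ⟨(v - u - 1) / 8, by omega, by omega, ?_⟩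
    have : u + 8 * ((v - u - 1) / 8) < v ∧ v ≤ u + 8 * ((v - u - 1) / 8) + 8 := by omega
    unfold chunk5S
    simp only [this, and_self, or_true]

theorem assemble_top {a n : ℕ} {N : ℤ}
    (top : Good (2 * N + 1) 3 n (fun v => v ≤ n ∨ (N - 2 * n < v ∧ v ≤ N)))
    (hN : N = ((3 + a : ℕ) : ℤ) * n) (fill : Fill a n) : HA (3 + a) n := by
  unfold HA
  rw [← hN]
  refine (top.vcat (fill (2 * N + 1) n)).mono fun v hv hs => ?_
  push_cast at hN
  have : N - 2 * n = n + a * n := by rw [hN]; ring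
  omega

theorem assemble_corner {a b : ℕ} {N K : ℤ} {S1 S2 : ℤ → Prop}
    (top : Good (2 * N + 1) 3 (3 + b) S1) (left : Good (2 * N + 1) 3 a S2)
    (cov : ∀ v, 0 < v → (v ≤ K ∨ (N - 2 * K < v ∧ v ≤ N)) → S1 v ∨ S2 v)
    (hN : N = ((3 + a : ℕ) : ℤ) * (3 + b : ℕ)) (hK : K = a + b + 3)
    (fill : Fill a b) : HA (3 + a) (3 + b) := by
  unfold HA
  rw [← hN]
  refine (top.vcat (left.trans.hcat (fill (2 * N + 1) K))).mono fun v hv hs => ?_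
  push_cast at hN
  have h1 : N - 2 * K = K + a * b := by rw [hN, hK]; ring
  by_cases h2 : v ≤ K ∨ (N - 2 * K < v ∧ v ≤ N)
  · rcases cov v hv h2 with h | h
    · exact Or.inl h
    · exact Or.inr (Or.inl h)
  · exact Or.inr (Or.inr (by omega))

theorem ha_odd_even (a n : ℕ) (ha : Even a) (ha2 : a ≠ 2) (hn : Even n) (hn4 : 4 ≤ n) :
    HA (3 + a) n := by
  have fill := fill_even a n ha hn ha2 (by omega)
  refine assemble_top (N := ((3 + a : ℕ) : ℤ) * n) ?_ rfl fill
  generalize ((3 + a : ℕ) : ℤ) * n = N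
  obtain ⟨k, hk⟩ := hn
  have hcase : n = 4 ∨ (∃ t, n = 6 + 4 * t) ∨ (∃ t, n = 8 + 4 * t) := by
    by_cases h4 : n = 4
    · exact Or.inl h4
    · rcases Nat.even_or_odd' k with ⟨c, hc | hc⟩
      · exact Or.inr (Or.inr ⟨c - 2, by omega⟩)
      · exact Or.inr (Or.inl ⟨c - 1, by omega⟩)
  rcases hcase with rfl | ⟨t, rfl⟩ | ⟨t, rfl⟩
  · refine (top4 N).mono fun v _ hs => ?_
    push_cast at hs
    omega
  · refine (one_arm t (core6 N t (by positivity))).mono fun v _ hs => ?_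
    push_cast at hs
    omega
  · refine (one_arm t (core8 N t (by positivity))).mono fun v _ hs => ?_
    push_cast at hs
    omega

theorem ha_five (n : ℕ) (hn : 4 ≤ n) : HA 5 n := by
  have hcase : n = 4 ∨ n = 5 ∨ (∃ t, n = 6 + 4 * t) ∨ (∃ t, n = 7 + 4 * t) ∨
      (∃ t, n = 8 + 4 * t) ∨ (∃ t, n = 9 + 4 * t) := by
    by_cases h4 : n = 4
    · exact Or.inl h4
    by_cases h5 : n = 5
    · exact Or.inr (Or.inl h5)
    right; right
    have h : n % 4 = 2 ∨ n % 4 = 3 ∨ n % 4 = 0 ∨ n % 4 = 1 := by omega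
    rcases h with h | h | h | h
    · exact Or.inl ⟨(n - 6) / 4, by omega⟩
    · exact Or.inr (Or.inl ⟨(n - 7) / 4, by omega⟩)
    · exact Or.inr (Or.inr (Or.inl ⟨(n - 8) / 4, by omega⟩))
    · exact Or.inr (Or.inr (Or.inr ⟨(n - 9) / 4, by omega⟩))
  rcases hcase with rfl | rfl | ⟨t, rfl⟩ | ⟨t, rfl⟩ | ⟨t, rfl⟩ | ⟨t, rfl⟩
  · exact ha54
  · exact ha55
  · exact one_arm5 t (Or.inl rfl) (core5_6 _ t (by positivity)) (by push_cast; ring)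
  · exact one_arm5 t (Or.inr rfl) (core5_7 _ t (by positivity)) (by push_cast; ring)
  · exact one_arm5 t (Or.inl rfl) (core5_8 _ t (by positivity)) (by push_cast; ring)
  · exact one_arm5 t (Or.inl rfl) (core5_9 _ t (by positivity)) (by push_cast; ring)

theorem ha_33 (x y : ℕ) : HA (3 + 4 * y) (3 + (4 + 4 * x)) := by
  obtain ⟨S1, S2, h1, h2, h3⟩ := arms x y
    (core7 (((3 + 4 * y : ℕ) : ℤ) * (3 + (4 + 4 * x) : ℕ)) ((x : ℤ) + y) (by positivity))
    (Good.empty_right _ 3) (fun v _ hr hf => Or.inl ⟨hr, hf⟩)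
  rw [show 7 + 4 * x = 3 + (4 + 4 * x) by omega] at h1
  rw [Nat.zero_add] at h2
  refine assemble_corner (K := 4 * ((x : ℤ) + y) + 7) h1 h2 (fun v hv hr => h3 v hv ?_) rfl
    (by push_cast; ring) (fill_even _ _ ⟨2 * y, by ring⟩ ⟨2 + 2 * x, by ring⟩ (by omega) (by omega))
  omega

theorem ha_31 (x y : ℕ) : HA (3 + 4 * y) (3 + (6 + 4 * x)) := by
  obtain ⟨S1, S2, h1, h2, h3⟩ := arms x y
    (core9 (((3 + 4 * y : ℕ) : ℤ) * (3 + (6 + 4 * x) : ℕ)) ((x : ℤ) + y) (by positivity))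
    (Good.empty_right _ 3) (fun v _ hr hf => Or.inl ⟨hr, hf⟩)
  rw [show 9 + 4 * x = 3 + (6 + 4 * x) by omega] at h1
  rw [Nat.zero_add] at h2
  refine assemble_corner (K := 4 * ((x : ℤ) + y) + 9) h1 h2 (fun v hv hr => h3 v hv ?_) rfl
    (by push_cast; ring) (fill_even _ _ ⟨2 * y, by ring⟩ ⟨3 + 2 * x, by ring⟩ (by omega) (by omega))
  omega

theorem ha_11 (x y : ℕ) : HA (3 + (6 + 4 * y)) (3 + (6 + 4 * x)) := by
  obtain ⟨S, S', g1, g2, g3⟩ :=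
    core15 (((3 + (6 + 4 * y) : ℕ) : ℤ) * (3 + (6 + 4 * x) : ℕ)) ((x : ℤ) + y) (by positivity)
  obtain ⟨S1, S2, h1, h2, h3⟩ := arms x y g1 g2 g3
  rw [show 9 + 4 * x = 3 + (6 + 4 * x) by omega] at h1
  refine assemble_corner (K := 4 * ((x : ℤ) + y) + 15) h1 h2 (fun v hv hr => h3 v hv ?_) rfl
    (by push_cast; ring)
    (fill_even _ _ ⟨3 + 2 * y, by ring⟩ ⟨3 + 2 * x, by ring⟩ (by omega) (by omega))
  omega

theorem ha_even (m n : ℕ) (hm : 3 ≤ m) (hn : 3 ≤ n) (em : Even m) (en : Even n) : HA m n := by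
  refine (fill_even m n em en (by omega) (by omega) _ 0).mono fun v hv hs => ?_
  constructor <;> linarith

theorem ha_oe (m n : ℕ) (hm : 3 ≤ m) (hn : 3 ≤ n) (om : m % 2 = 1) (en : n % 2 = 0) :
    HA m n := by
  by_cases h5 : m = 5
  · subst h5
    exact ha_five n (by omega)
  · have := ha_odd_even (m - 3) n (Nat.even_iff.2 (by omega)) (by omega) (Nat.even_iff.2 en)
      (by omega)
    rwa [show 3 + (m - 3) = m by omega] at this

theorem ha_all (m n : ℕ) (hm : 3 ≤ m) (hn : 3 ≤ n) : HA m n := by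
  rcases Nat.mod_two_eq_zero_or_one m with em | om <;>
    rcases Nat.mod_two_eq_zero_or_one n with en | on
  · exact ha_even m n hm hn (Nat.even_iff.2 em) (Nat.even_iff.2 en)
  · exact (ha_oe n m hn hm on em).trans
  · exact ha_oe m n hm hn om en
  · by_cases h5 : m = 5
    · subst h5
      by_cases h3 : n = 3
      · subst h3
        exact ha35.trans
      · exact ha_five n (by omega)
    by_cases h5' : n = 5
    · subst h5'
      by_cases h3 : m = 3
      · subst h3
        exact ha35
      · exact (ha_five m (by omega)).trans
    rcases (show m % 4 = 3 ∨ m % 4 = 1 by omega) with a | a <;>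
      rcases (show n % 4 = 3 ∨ n % 4 = 1 by omega) with b | b
    · by_cases h3 : n = 3
      · subst h3
        by_cases h3' : m = 3
        · subst h3'
          exact ha33
        · have := (ha_33 ((m - 7) / 4) 0).trans
          rwa [show 3 + (4 + 4 * ((m - 7) / 4)) = m by omega] at this
      · have := ha_33 ((n - 7) / 4) ((m - 3) / 4)
        rwa [show 3 + (4 + 4 * ((n - 7) / 4)) = n by omega,
          show 3 + 4 * ((m - 3) / 4) = m by omega] at this
    · have := ha_31 ((n - 9) / 4) ((m - 3) / 4)
      rwa [show 3 + (6 + 4 * ((n - 9) / 4)) = n by omega,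
        show 3 + 4 * ((m - 3) / 4) = m by omega] at this
    · have := (ha_31 ((m - 9) / 4) ((n - 3) / 4)).trans
      rwa [show 3 + (6 + 4 * ((m - 9) / 4)) = m by omega,
        show 3 + 4 * ((n - 3) / 4) = n by omega] at this
    · have := ha_11 ((n - 9) / 4) ((m - 9) / 4)
      rwa [show 3 + (6 + 4 * ((n - 9) / 4)) = n by omega,
        show 3 + (6 + 4 * ((m - 9) / 4)) = m by omega] at this


/-- For all m, n ≥ 3 there exists a tight Heffter array H(m,n). -/
theorem stmt_18 (m n : ℕ) (hm : 3 ≤ m) (hn : 3 ≤ n) :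
    ∃ A : Fin m → Fin n → ℤ,
      (∀ i, (2 * (m : ℤ) * n + 1) ∣ ∑ j, A i j) ∧
      (∀ j, (2 * (m : ℤ) * n + 1) ∣ ∑ i, A i j) ∧
      (∀ v ∈ Finset.Icc (1 : ℤ) (m * n), ∃! p : Fin m × Fin n, |A p.1 p.2| = v) :=
  (ha_all m n hm hn).final
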